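/- arXiv:1404.7068 — 6 statements merged into one kernel-verified Lean document; each statement's English description precedes it below -/
import Mathlib

section
/- Let 1 ≤ p < q < ∞, δ > 0, and let φ : [0,∞) → [0,∞) be quasi-concave and such that t ↦ φ(t)^q/t is nonincreasing on (0,δ). Then φ(t)^p · (1/t) ∫₀^t φ(s)^{−p} ds ≤ q/(q−p) for every t ∈ (0,δ); moreover sup_{0<t<1} φ(t)^p · (1/t) ∫₀^t φ(s)^{−p} ds < ∞. -/
open MeasureTheory
open scoped ENNReal

/-- A function `φ : [0,∞) → [0,∞)` is quasi-concave: `φ 0 = 0`, `φ > 0` on `(0,∞)`,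
`φ` is nondecreasing on `[0,∞)`, and `t ↦ φ t / t` is nonincreasing on `(0,∞)`. -/
def QuasiConcave (φ : ℝ → ℝ) : Prop :=
  φ 0 = 0 ∧ (∀ t : ℝ, 0 < t → 0 < φ t) ∧ MonotoneOn φ (Set.Ici 0) ∧
    AntitoneOn (fun t => φ t / t) (Set.Ioi 0)

theorem lintegral_Ioo_rpow_neg {a t : ℝ} (ha : a < 1) (ht : 0 < t) :
    ∫⁻ s in Set.Ioo (0 : ℝ) t, ENNReal.ofReal (s ^ (-a)) =
      ENNReal.ofReal (t ^ (1 - a) / (1 - a)) := by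
  have hint : IntegrableOn (fun s : ℝ => s ^ (-a)) (Set.Ioo 0 t) :=
    (intervalIntegral.integrableOn_Ioo_rpow_iff ht).2 (by linarith)
  rw [← ofReal_integral_eq_lintegral_ofReal hint
    (ae_restrict_of_forall_mem measurableSet_Ioo fun s hs => Real.rpow_nonneg hs.1.le _),
    ← integral_Ioc_eq_integral_Ioo, ← intervalIntegral.integral_of_le ht.le,
    integral_rpow (Or.inl (by linarith)), Real.zero_rpow (by linarith), sub_zero,
    neg_add_eq_sub]

theorem rpow_div_rpow_le_of_antitoneOn {p q δ : ℝ} (hp : 0 ≤ p) (hq : 0 < q) {φ : ℝ → ℝ}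
    (hpos : ∀ t : ℝ, 0 < t → 0 < φ t)
    (hφq : AntitoneOn (fun t => φ t ^ q / t) (Set.Ioo (0 : ℝ) δ))
    {s t : ℝ} (hs : 0 < s) (hst : s ≤ t) (ht : t < δ) :
    φ t ^ p / φ s ^ p ≤ t ^ (p / q) * s ^ (-(p / q)) := by
  have ht0 : 0 < t := hs.trans_le hst
  have hφs := hpos s hs
  have hφt := hpos t ht0
  have h : φ t ^ q / t ≤ φ s ^ q / s := hφq ⟨hs, hst.trans_lt ht⟩ ⟨ht0, ht⟩ hst
  have h' : (φ t / φ s) ^ q ≤ t / s := by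
    rw [Real.div_rpow hφt.le hφs.le, div_le_div_iff₀ (by positivity) hs]
    rw [div_le_div_iff₀ ht0 hs] at h
    linarith
  have key := Real.rpow_le_rpow (by positivity) h' (div_nonneg hp hq.le)
  rwa [← Real.rpow_mul (by positivity), mul_div_cancel₀ _ hq.ne', Real.div_rpow hφt.le hφs.le,
    Real.div_rpow ht0.le hs.le, div_eq_mul_inv (t ^ (p / q)), ← Real.rpow_neg hs.le] at key

theorem averaged_lintegral_le {p q δ : ℝ} (hp : 0 ≤ p) (hpq : p < q) {φ : ℝ → ℝ}
    (hpos : ∀ t : ℝ, 0 < t → 0 < φ t)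
    (hφq : AntitoneOn (fun t => φ t ^ q / t) (Set.Ioo (0 : ℝ) δ))
    {t : ℝ} (ht : t ∈ Set.Ioo 0 δ) :
    ENNReal.ofReal (φ t ^ p) * ((ENNReal.ofReal t)⁻¹ *
      ∫⁻ s in Set.Ioo (0 : ℝ) t, ENNReal.ofReal (1 / φ s ^ p)) ≤
        ENNReal.ofReal (q / (q - p)) := by
  have hq : 0 < q := hp.trans_lt hpq
  have ht0 : 0 < t := ht.1
  have ha : p / q < 1 := (div_lt_one hq).2 hpq
  have hφt : 0 ≤ φ t ^ p := Real.rpow_nonneg (hpos t ht0).le p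
  rw [mul_left_comm, ← lintegral_const_mul' _ _ ENNReal.ofReal_ne_top,
    ← ENNReal.ofReal_inv_of_pos ht0]
  calc
    _ ≤ ENNReal.ofReal t⁻¹ * ∫⁻ s in Set.Ioo (0 : ℝ) t,
          ENNReal.ofReal (t ^ (p / q)) * ENNReal.ofReal (s ^ (-(p / q))) := by
      refine mul_le_mul_right (setLIntegral_mono' measurableSet_Ioo fun s hs => ?_) _
      rw [← ENNReal.ofReal_mul hφt, ← ENNReal.ofReal_mul (by positivity), mul_one_div]
      exact ENNReal.ofReal_le_ofReal
        (rpow_div_rpow_le_of_antitoneOn hp hq hpos hφq hs.1 hs.2.le ht.2)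
    _ = ENNReal.ofReal (q / (q - p)) := by
      rw [lintegral_const_mul' _ _ ENNReal.ofReal_ne_top, lintegral_Ioo_rpow_neg ha ht0,
        ← ENNReal.ofReal_mul (by positivity), ← ENNReal.ofReal_mul (by positivity),
        ← mul_div_assoc, ← Real.rpow_add ht0, add_sub_cancel, Real.rpow_one, ← mul_div_assoc,
        inv_mul_cancel₀ ht0.ne', one_sub_div hq.ne', one_div_div]

theorem lintegral_one_div_rpow_lt_top {p q δ b : ℝ} (hp : 0 ≤ p) (hpq : p < q) (hδ : 0 < δ)
    {φ : ℝ → ℝ} (hφ : QuasiConcave φ)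
    (hφq : AntitoneOn (fun t => φ t ^ q / t) (Set.Ioo (0 : ℝ) δ)) :
    ∫⁻ s in Set.Ioo (0 : ℝ) b, ENNReal.ofReal (1 / φ s ^ p) < ⊤ := by
  obtain ⟨-, hpos, hmono, -⟩ := hφ
  obtain ⟨c, hc, hcδ⟩ := exists_between hδ
  have hφc := hpos c hc
  have hnear : ∫⁻ s in Set.Ioo (0 : ℝ) c, ENNReal.ofReal (1 / φ s ^ p) < ⊤ := by
    have h := (averaged_lintegral_le hp hpq hpos hφq ⟨hc, hcδ⟩).trans_lt ENNReal.ofReal_lt_top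
    have h₁ := ENNReal.lt_top_of_mul_ne_top_right h.ne
      (ENNReal.ofReal_pos.2 (Real.rpow_pos_of_pos hφc p)).ne'
    exact ENNReal.lt_top_of_mul_ne_top_right h₁.ne
      (ENNReal.inv_ne_zero.2 ENNReal.ofReal_ne_top)
  have hfar : ∫⁻ s in Set.Ico c b, ENNReal.ofReal (1 / φ s ^ p) < ⊤ := by
    refine setLIntegral_lt_top_of_le_nnreal (by simp) ⟨(1 / φ c ^ p).toNNReal, fun s hs => ?_⟩
    refine ENNReal.ofReal_le_ofReal (one_div_le_one_div_of_le (by positivity) ?_)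
    exact Real.rpow_le_rpow hφc.le (hmono hc.le (hc.le.trans hs.1) hs.1) hp
  have hsub : Set.Ioo 0 b ⊆ Set.Ioo 0 c ∪ Set.Ico c b := fun s hs =>
    (lt_or_ge s c).imp (fun h => ⟨hs.1, h⟩) fun h => ⟨h, hs.2⟩
  exact ((lintegral_mono_set hsub).trans (lintegral_union_le _ _ _)).trans_lt
    (ENNReal.add_lt_top.2 ⟨hnear, hfar⟩)

/-- **Local quasi-concavity of `φ^q` implies the averaged condition:** if `1 ≤ p < q < ∞`,
`δ > 0`, `φ` is quasi-concave and `t ↦ φ(t)^q / t` is nonincreasing on `(0,δ)`, then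
`φ(t)^p (1/t) ∫₀^t φ(s)^{−p} ds ≤ q/(q−p)` for every `t ∈ (0,δ)`; moreover
`sup_{0<t<1} φ(t)^p (1/t) ∫₀^t φ(s)^{−p} ds < ∞`. -/
theorem averaged_condition_of_quasiConcave_pow
    (p q δ : ℝ) (hp : 1 ≤ p) (hpq : p < q) (hδ : 0 < δ)
    (φ : ℝ → ℝ) (hφ : QuasiConcave φ)
    (hφq : AntitoneOn (fun t => φ t ^ q / t) (Set.Ioo (0 : ℝ) δ)) :
    (∀ t ∈ Set.Ioo (0 : ℝ) δ,
      ENNReal.ofReal (φ t ^ p) * ((ENNReal.ofReal t)⁻¹ *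
          ∫⁻ s in Set.Ioo (0 : ℝ) t, ENNReal.ofReal (1 / φ s ^ p)) ≤
        ENNReal.ofReal (q / (q - p))) ∧
    (⨆ t ∈ Set.Ioo (0 : ℝ) 1,
        ENNReal.ofReal (φ t ^ p) * ((ENNReal.ofReal t)⁻¹ *
          ∫⁻ s in Set.Ioo (0 : ℝ) t, ENNReal.ofReal (1 / φ s ^ p))) < ⊤ := by
  have hp0 : 0 ≤ p := zero_le_one.trans hp
  have hpos := hφ.2.1
  refine ⟨fun t ht => averaged_lintegral_le hp0 hpq hpos hφq ht, ?_⟩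
  have hfin : ENNReal.ofReal (φ 1 ^ p) * ((ENNReal.ofReal δ)⁻¹ *
      ∫⁻ s in Set.Ioo (0 : ℝ) 1, ENNReal.ofReal (1 / φ s ^ p)) < ⊤ :=
    ENNReal.mul_lt_top ENNReal.ofReal_lt_top (ENNReal.mul_lt_top
      (ENNReal.inv_lt_top.2 (ENNReal.ofReal_pos.2 hδ))
      (lintegral_one_div_rpow_lt_top hp0 hpq hδ hφ hφq))
  refine lt_of_le_of_lt (iSup₂_le fun t ht => ?_)
    (max_lt (ENNReal.ofReal_lt_top (r := q / (q - p))) hfin)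
  rcases lt_or_ge t δ with h | h
  · exact (averaged_lintegral_le hp0 hpq hpos hφq ⟨ht.1, h⟩).trans (le_max_left _ _)
  · refine le_trans ?_ (le_max_right _ _)
    have hφt : φ t ≤ φ 1 := hφ.2.2.1 ht.1.le (Set.mem_Ici.2 zero_le_one) ht.2.le
    gcongr
    · exact (hpos t ht.1).le
    · exact ht.2.le
end

section
/- Let 1 ≤ p < q < ∞ and let φ : (0,∞) → (0,∞) be such that t ↦ φ(t)^q/t is nonincreasing on (0,∞). Then sup_{t>0} φ(t)^p · (1/t) ∫₀^t φ(s)^{−p} ds ≤ q/(q−p). In particular, if φ is quasi-concave and φ^q is quasi-concave for some q > p ≥ 1, then for every nonincreasing f : (0,∞) → [0,∞], sup_{t>0} A_p f(t)·φ(t) ≤ (q/(q−p))^{1/p} · sup_{t>0} f(t)·φ(t), i.e., M_p is bounded from M^*_φ to M^*_φ. -/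
open MeasureTheory
open scoped ENNReal

/-- The maximal average `A_p f (t) = ((1/t) ∫₀^t f(s)^p ds)^{1/p}`, which for a
nonincreasing `f : (0,∞) → [0,∞]` equals the non-centered maximal function `M_p f (t)`
on `(0,∞)` with Lebesgue measure. -/
noncomputable def Ap (p : ℝ) (f : ℝ → ℝ≥0∞) (t : ℝ) : ℝ≥0∞ :=
  ((ENNReal.ofReal t)⁻¹ * ∫⁻ s in Set.Ioo (0 : ℝ) t, f s ^ p) ^ (1 / p)

/-- The integral of a power with exponent in `(-1, ∞)` over `(0, t)`, as a lower integral. -/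
lemma lintegral_Ioo_zero_rpow {r t : ℝ} (hr : -1 < r) (ht : 0 < t) :
    ∫⁻ s in Set.Ioo (0 : ℝ) t, ENNReal.ofReal (s ^ r) =
      ENNReal.ofReal (t ^ (r + 1) / (r + 1)) := by
  have hint : IntegrableOn (fun s : ℝ => s ^ r) (Set.Ioo 0 t) :=
    (intervalIntegral.integrableOn_Ioo_rpow_iff ht).2 hr
  rw [← ofReal_integral_eq_lintegral_ofReal hint
    ((ae_restrict_iff' measurableSet_Ioo).2 (.of_forall fun s hs => Real.rpow_nonneg hs.1.le r)),
    ← integral_Ioc_eq_integral_Ioo, ← intervalIntegral.integral_of_le ht.le,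
    integral_rpow (Or.inl hr), Real.zero_rpow (by linarith), sub_zero]

/-- If `φ ^ q / t` is nonincreasing, then `φ(s)^{-p}` is at most `(t / s)^{p / q} φ(t)^{-p}`
for `s ≤ t`. -/
lemma one_div_rpow_le_of_antitoneOn_rpow_div {p q : ℝ} (hp : 0 ≤ p) (hq : 0 < q)
    {φ : ℝ → ℝ} (hφpos : ∀ t : ℝ, 0 < t → 0 < φ t)
    (hφq : AntitoneOn (fun t => φ t ^ q / t) (Set.Ioi (0 : ℝ)))
    {s t : ℝ} (hs : 0 < s) (hst : s ≤ t) :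
    1 / φ s ^ p ≤ t ^ (p / q) / φ t ^ p * s ^ (-(p / q)) := by
  have ht : 0 < t := hs.trans_le hst
  have hφs := hφpos s hs
  have hφt := hφpos t ht
  have hmono : φ t ^ q / t ≤ φ s ^ q / s := hφq hs ht hst
  have hpow := Real.rpow_le_rpow (by positivity) hmono (div_nonneg hp hq.le)
  rw [Real.div_rpow (by positivity) ht.le, Real.div_rpow (by positivity) hs.le,
    ← Real.rpow_mul hφt.le, ← Real.rpow_mul hφs.le, mul_div_cancel₀ p hq.ne',
    div_le_div_iff₀ (by positivity) (by positivity)] at hpow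
  rw [Real.rpow_neg hs.le, ← div_eq_mul_inv, div_div, div_le_div_iff₀ (by positivity)
    (by positivity)]
  linarith

/-- If `φ ^ q / t` is nonincreasing and `p < q`, then the average of `φ ^ (-p)` over `(0, t)` is
at most `q / (q - p)` times `φ(t)^{-p}`. -/
lemma ofReal_rpow_mul_average_one_div_rpow_le {p q : ℝ} (hp : 0 ≤ p) (hpq : p < q)
    {φ : ℝ → ℝ} (hφpos : ∀ t : ℝ, 0 < t → 0 < φ t)
    (hφq : AntitoneOn (fun t => φ t ^ q / t) (Set.Ioi (0 : ℝ))) {t : ℝ} (ht : 0 < t) :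
    ENNReal.ofReal (φ t ^ p) * ((ENNReal.ofReal t)⁻¹ *
        ∫⁻ s in Set.Ioo (0 : ℝ) t, ENNReal.ofReal (1 / φ s ^ p)) ≤
      ENNReal.ofReal (q / (q - p)) := by
  have hq : 0 < q := hp.trans_lt hpq
  have hφt := hφpos t ht
  have hr : p / q < 1 := (div_lt_one hq).2 hpq
  have hbound : ∫⁻ s in Set.Ioo (0 : ℝ) t, ENNReal.ofReal (1 / φ s ^ p) ≤
      ENNReal.ofReal (t ^ (p / q) / φ t ^ p) *
        ENNReal.ofReal (t ^ (-(p / q) + 1) / (-(p / q) + 1)) := by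
    rw [← lintegral_Ioo_zero_rpow (by linarith) ht, ← lintegral_const_mul' _ _ ENNReal.ofReal_ne_top]
    refine setLIntegral_mono' measurableSet_Ioo fun s hs => ?_
    rw [← ENNReal.ofReal_mul (by positivity)]
    exact ENNReal.ofReal_le_ofReal
      (one_div_rpow_le_of_antitoneOn_rpow_div hp hq hφpos hφq hs.1 hs.2.le)
  grw [hbound]
  rw [← ENNReal.ofReal_inv_of_pos ht, ← ENNReal.ofReal_mul (by positivity),
    ← ENNReal.ofReal_mul (by positivity), ← ENNReal.ofReal_mul (by positivity)]
  refine ENNReal.ofReal_le_ofReal (le_of_eq ?_)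
  have hden : q - p ≠ 0 := by linarith
  have hden' : -(p / q) + 1 = (q - p) / q := by field_simp; ring
  rw [Real.rpow_add ht, Real.rpow_one, Real.rpow_neg ht.le, hden']
  field_simp

/-- **Global quasi-concavity of `φ^q` implies global boundedness of `M_p` on `M^*_φ`:**
let `1 ≤ p < q < ∞` and `φ : (0,∞) → (0,∞)` with `t ↦ φ(t)^q / t` nonincreasing on
`(0,∞)`. Then `sup_{t>0} φ(t)^p (1/t) ∫₀^t φ(s)^{−p} ds ≤ q/(q−p)`. In particular, if
`φ` is moreover quasi-concave (with `φ^q` quasi-concave), then for every nonincreasing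
`f : (0,∞) → [0,∞]`,
`sup_{t>0} A_p f(t) φ(t) ≤ (q/(q−p))^{1/p} · sup_{t>0} f(t) φ(t)`. -/
theorem maximal_bounded_weakMarcinkiewicz_of_quasiConcave_pow
    (p q : ℝ) (hp : 1 ≤ p) (hpq : p < q)
    (φ : ℝ → ℝ) (hφpos : ∀ t : ℝ, 0 < t → 0 < φ t)
    (hφq : AntitoneOn (fun t => φ t ^ q / t) (Set.Ioi (0 : ℝ))) :
    (⨆ t ∈ Set.Ioi (0 : ℝ),
        ENNReal.ofReal (φ t ^ p) * ((ENNReal.ofReal t)⁻¹ *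
          ∫⁻ s in Set.Ioo (0 : ℝ) t, ENNReal.ofReal (1 / φ s ^ p))) ≤
      ENNReal.ofReal (q / (q - p)) ∧
    ((φ 0 = 0 ∧ MonotoneOn φ (Set.Ici 0) ∧ AntitoneOn (fun t => φ t / t) (Set.Ioi 0) ∧
        MonotoneOn (fun t => φ t ^ q) (Set.Ici 0)) →
      ∀ f : ℝ → ℝ≥0∞, AntitoneOn f (Set.Ioi 0) →
        (⨆ t ∈ Set.Ioi (0 : ℝ), Ap p f t * ENNReal.ofReal (φ t)) ≤
          ENNReal.ofReal ((q / (q - p)) ^ (1 / p)) *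
            ⨆ t ∈ Set.Ioi (0 : ℝ), f t * ENNReal.ofReal (φ t)) := by
  have hp0 : 0 < p := by linarith
  have hqp : 0 < q / (q - p) := div_pos (by linarith) (by linarith)
  have havg := fun t (ht : 0 < t) =>
    ofReal_rpow_mul_average_one_div_rpow_le hp0.le hpq hφpos hφq ht
  refine ⟨iSup₂_le havg, fun _ f _ => iSup₂_le fun t (ht : 0 < t) => ?_⟩
  set S := ⨆ t ∈ Set.Ioi (0 : ℝ), f t * ENNReal.ofReal (φ t)
  rcases eq_or_ne S ⊤ with hStop | hStop
  · rw [hStop, ENNReal.mul_top (by simpa using Real.rpow_pos_of_pos hqp _)]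
    exact le_top
  have hf : ∀ s ∈ Set.Ioo (0 : ℝ) t, f s ^ p ≤ S ^ p * ENNReal.ofReal (1 / φ s ^ p) := by
    intro s hs
    have hφs := hφpos s hs.1
    have hle : f s * ENNReal.ofReal (φ s) ≤ S :=
      le_iSup₂ (f := fun t (_ : t ∈ Set.Ioi (0 : ℝ)) => f t * ENNReal.ofReal (φ t)) s hs.1
    have hdiv : f s ≤ S / ENNReal.ofReal (φ s) :=
      (ENNReal.le_div_iff_mul_le (by simp [hφs]) (by simp)).2 hle
    calc f s ^ p ≤ (S / ENNReal.ofReal (φ s)) ^ p := by gcongr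
      _ = S ^ p * ENNReal.ofReal (1 / φ s ^ p) := by
        rw [ENNReal.div_rpow_of_nonneg _ _ hp0.le, ENNReal.ofReal_rpow_of_pos hφs, one_div,
          ENNReal.ofReal_inv_of_pos (by positivity), div_eq_mul_inv]
  have hint : ∫⁻ s in Set.Ioo (0 : ℝ) t, f s ^ p ≤
      S ^ p * ∫⁻ s in Set.Ioo (0 : ℝ) t, ENNReal.ofReal (1 / φ s ^ p) := by
    rw [← lintegral_const_mul' _ _ (ENNReal.rpow_ne_top_of_nonneg hp0.le hStop)]
    exact setLIntegral_mono' measurableSet_Ioo hf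
  have hroot : ∀ x : ℝ≥0∞, (x ^ p) ^ (1 / p) = x := fun x => by
    rw [one_div, ENNReal.rpow_rpow_inv hp0.ne']
  have hp1 : 0 ≤ 1 / p := by positivity
  calc Ap p f t * ENNReal.ofReal (φ t)
      = ((ENNReal.ofReal t)⁻¹ * (∫⁻ s in Set.Ioo (0 : ℝ) t, f s ^ p) *
          ENNReal.ofReal (φ t ^ p)) ^ (1 / p) := by
        rw [Ap, ENNReal.mul_rpow_of_nonneg _ (ENNReal.ofReal (φ t ^ p)) hp1,
          ← ENNReal.ofReal_rpow_of_pos (hφpos t ht), hroot]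
    _ ≤ ((ENNReal.ofReal t)⁻¹ *
          (S ^ p * ∫⁻ s in Set.Ioo (0 : ℝ) t, ENNReal.ofReal (1 / φ s ^ p)) *
          ENNReal.ofReal (φ t ^ p)) ^ (1 / p) := by gcongr
    _ = (ENNReal.ofReal (φ t ^ p) * ((ENNReal.ofReal t)⁻¹ *
          ∫⁻ s in Set.Ioo (0 : ℝ) t, ENNReal.ofReal (1 / φ s ^ p)) * S ^ p) ^ (1 / p) := by
        ring_nf
    _ ≤ (ENNReal.ofReal (q / (q - p)) * S ^ p) ^ (1 / p) := by
        gcongr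
        exact havg t ht
    _ = ENNReal.ofReal ((q / (q - p)) ^ (1 / p)) * S := by
        rw [ENNReal.mul_rpow_of_nonneg _ _ hp1, hroot, ENNReal.ofReal_rpow_of_pos hqp]
end

section
/- Let φ be quasi-concave, p ∈ [1,∞), and define m_φ(s) = sup_{0<t<1} φ(t)/φ(st) for s ∈ (0,1). If ∫₀^1 m_φ(s)^p ds < ∞, then for every t ∈ (0,1): φ(t)^p · (1/t) ∫₀^t φ(s)^{−p} ds ≤ ∫₀^1 m_φ(s)^p ds; in particular sup_{0<t<1} φ(t)^p · (1/t) ∫₀^t φ(s)^{−p} ds < ∞. -/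
open MeasureTheory
open scoped ENNReal

/-- The modulus of quasi-concavity `m_φ(s) = sup_{0<t<1} φ(t)/φ(st)` for `s ∈ (0,1)`. -/
noncomputable def mPhi (φ : ℝ → ℝ) (s : ℝ) : ℝ :=
  sSup {y : ℝ | ∃ t : ℝ, 0 < t ∧ t < 1 ∧ y = φ t / φ (s * t)}

/-- The supremum defining `mPhi φ s` is over a set bounded by `1 / s`, so it is an upper bound. -/
theorem QuasiConcave.div_le_mPhi {φ : ℝ → ℝ} (hφ : QuasiConcave φ) {s t : ℝ}
    (hs : s ∈ Set.Ioo (0 : ℝ) 1) (ht : t ∈ Set.Ioo (0 : ℝ) 1) :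
    φ t / φ (s * t) ≤ mPhi φ s := by
  obtain ⟨-, hpos, -, hanti⟩ := hφ
  refine le_csSup ⟨1 / s, ?_⟩ ⟨t, ht.1, ht.2, rfl⟩
  rintro _ ⟨u, hu, -, rfl⟩
  have hsu : 0 < s * u := mul_pos hs.1 hu
  have h : φ u / u ≤ φ (s * u) / (s * u) :=
    hanti hsu hu (mul_le_of_le_one_left hu.le hs.2.le)
  rw [div_le_div_iff₀ hu hsu] at h
  rw [div_le_div_iff₀ (hpos _ hsu) hs.1]
  nlinarith

/-- Rescaling `(0, t)` to `(0, 1)` turns an average over `(0, t)` into an integral. -/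
theorem inv_mul_setLIntegral_Ioo {t : ℝ} (ht : 0 < t) (g : ℝ → ℝ≥0∞) :
    (ENNReal.ofReal t)⁻¹ * ∫⁻ s in Set.Ioo (0 : ℝ) t, g s =
      ∫⁻ s in Set.Ioo (0 : ℝ) 1, g (s * t) := by
  have himage : (fun s : ℝ => s * t) '' Set.Ioo 0 1 = Set.Ioo 0 t := by
    rw [Set.image_mul_right_Ioo _ _ ht, zero_mul, one_mul]
  have hchange := lintegral_image_eq_lintegral_abs_deriv_mul
    (s := Set.Ioo (0 : ℝ) 1) (f := fun s : ℝ => s * t) (f' := fun _ => t) measurableSet_Ioo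
    (fun x _ => (hasDerivAt_mul_const t).hasDerivWithinAt)
    (mul_left_injective₀ ht.ne').injOn g
  rw [himage, abs_of_pos ht, lintegral_const_mul' _ _ ENNReal.ofReal_ne_top] at hchange
  rw [hchange, ← mul_assoc, ENNReal.inv_mul_cancel (by simpa using ht) ENNReal.ofReal_ne_top,
    one_mul]

/-- **Integrability of the modulus of quasi-concavity implies the averaged condition:**
if `φ` is quasi-concave, `p ∈ [1,∞)` and `∫₀^1 m_φ(s)^p ds < ∞`, then for every
`t ∈ (0,1)`, `φ(t)^p (1/t) ∫₀^t φ(s)^{−p} ds ≤ ∫₀^1 m_φ(s)^p ds`; in particular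
`sup_{0<t<1} φ(t)^p (1/t) ∫₀^t φ(s)^{−p} ds < ∞`. -/
theorem averaged_condition_of_modulus_in_Lp
    (φ : ℝ → ℝ) (hφ : QuasiConcave φ) (p : ℝ) (hp : 1 ≤ p)
    (hm : ∫⁻ s in Set.Ioo (0 : ℝ) 1, ENNReal.ofReal (mPhi φ s ^ p) < ⊤) :
    (∀ t ∈ Set.Ioo (0 : ℝ) 1,
      ENNReal.ofReal (φ t ^ p) * ((ENNReal.ofReal t)⁻¹ *
          ∫⁻ s in Set.Ioo (0 : ℝ) t, ENNReal.ofReal (1 / φ s ^ p)) ≤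
        ∫⁻ s in Set.Ioo (0 : ℝ) 1, ENNReal.ofReal (mPhi φ s ^ p)) ∧
    (⨆ t ∈ Set.Ioo (0 : ℝ) 1,
        ENNReal.ofReal (φ t ^ p) * ((ENNReal.ofReal t)⁻¹ *
          ∫⁻ s in Set.Ioo (0 : ℝ) t, ENNReal.ofReal (1 / φ s ^ p))) < ⊤ := by
  have hbound : ∀ t ∈ Set.Ioo (0 : ℝ) 1,
      ENNReal.ofReal (φ t ^ p) * ((ENNReal.ofReal t)⁻¹ *
          ∫⁻ s in Set.Ioo (0 : ℝ) t, ENNReal.ofReal (1 / φ s ^ p)) ≤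
        ∫⁻ s in Set.Ioo (0 : ℝ) 1, ENNReal.ofReal (mPhi φ s ^ p) := by
    intro t ht
    rw [inv_mul_setLIntegral_Ioo ht.1, ← lintegral_const_mul' _ _ ENNReal.ofReal_ne_top]
    refine setLIntegral_mono' measurableSet_Ioo fun s hs => ?_
    have hφt : 0 < φ t := hφ.2.1 t ht.1
    have hφst : 0 < φ (s * t) := hφ.2.1 _ (mul_pos hs.1 ht.1)
    rw [← ENNReal.ofReal_mul (by positivity), mul_one_div, ← Real.div_rpow hφt.le hφst.le]
    exact ENNReal.ofReal_le_ofReal <| Real.rpow_le_rpow (by positivity)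
      (hφ.div_le_mPhi hs ht) (by linarith)
  exact ⟨hbound, (iSup₂_le hbound).trans_lt hm⟩
end

section
/- Let φ be quasi-concave and p ∈ [1,∞). Define k(s) = sup_{t>0} φ(st)/φ(t) for s > 0, and m_φ(s) = sup_{0<t<1} φ(t)/φ(st) for s ∈ (0,1). If the upper fundamental index satisfies inf_{s>1} (log k(s))/(log s) < 1/p, then ∫₀^1 m_φ(s)^p ds < ∞. -/
open MeasureTheory
open scoped ENNReal

/-- The dilation function `k(s) = sup_{t>0} φ(st)/φ(t)`. -/
noncomputable def kPhi (φ : ℝ → ℝ) (s : ℝ) : ℝ :=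
  sSup {y : ℝ | ∃ t : ℝ, 0 < t ∧ y = φ (s * t) / φ t}

/-- Quasi-concavity gives `φ (s t) ≤ s φ t` for `s ≥ 1`. -/
theorem QuasiConcave.map_mul_le {φ : ℝ → ℝ} (hφ : QuasiConcave φ) {s t : ℝ} (hs : 1 ≤ s)
    (ht : 0 < t) : φ (s * t) ≤ s * φ t := by
  obtain ⟨-, -, -, hanti⟩ := hφ
  have hst : 0 < s * t := by positivity
  have h : φ (s * t) / (s * t) ≤ φ t / t :=
    hanti ht hst (le_mul_of_one_le_left ht.le hs)
  rw [div_le_iff₀ hst] at h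
  calc φ (s * t) ≤ φ t / t * (s * t) := h
    _ = s * φ t := by field_simp

theorem QuasiConcave.bddAbove_dilation {φ : ℝ → ℝ} (hφ : QuasiConcave φ) {s : ℝ} (hs : 1 ≤ s) :
    BddAbove {y : ℝ | ∃ t : ℝ, 0 < t ∧ y = φ (s * t) / φ t} := by
  refine ⟨s, ?_⟩
  rintro _ ⟨t, ht, rfl⟩
  rw [div_le_iff₀ (hφ.2.1 t ht)]
  exact hφ.map_mul_le hs ht

theorem QuasiConcave.map_mul_le_kPhi_mul {φ : ℝ → ℝ} (hφ : QuasiConcave φ) {s t : ℝ}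
    (hs : 1 ≤ s) (ht : 0 < t) : φ (s * t) ≤ kPhi φ s * φ t := by
  rw [← div_le_iff₀ (hφ.2.1 t ht)]
  exact le_csSup (hφ.bddAbove_dilation hs) ⟨t, ht, rfl⟩

theorem QuasiConcave.one_le_kPhi {φ : ℝ → ℝ} (hφ : QuasiConcave φ) {s : ℝ} (hs : 1 ≤ s) :
    1 ≤ kPhi φ s := by
  have h1 : φ 1 ≤ φ (s * 1) :=
    hφ.2.2.1 (Set.mem_Ici.2 zero_le_one) (Set.mem_Ici.2 (by positivity)) (by simpa using hs)
  have h2 := h1.trans (hφ.map_mul_le_kPhi_mul hs one_pos)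
  exact le_of_mul_le_mul_right (by simpa using h2) (hφ.2.1 1 one_pos)

theorem QuasiConcave.map_pow_mul_le {φ : ℝ → ℝ} (hφ : QuasiConcave φ) {s t : ℝ}
    (hs : 1 ≤ s) (ht : 0 < t) (n : ℕ) : φ (s ^ n * t) ≤ kPhi φ s ^ n * φ t := by
  induction n with
  | zero => simp
  | succ n ih =>
    have hk : 0 ≤ kPhi φ s := zero_le_one.trans (hφ.one_le_kPhi hs)
    calc φ (s ^ (n + 1) * t) = φ (s * (s ^ n * t)) := by ring_nf
      _ ≤ kPhi φ s * φ (s ^ n * t) := hφ.map_mul_le_kPhi_mul hs (by positivity)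
      _ ≤ kPhi φ s * (kPhi φ s ^ n * φ t) := by gcongr
      _ = kPhi φ s ^ (n + 1) * φ t := by ring

theorem QuasiConcave.mPhi_nonneg {φ : ℝ → ℝ} (hφ : QuasiConcave φ) {s : ℝ} (hs : 0 < s) :
    0 ≤ mPhi φ s := by
  refine Real.sSup_nonneg ?_
  rintro _ ⟨t, ht, -, rfl⟩
  exact (div_pos (hφ.2.1 t ht) (hφ.2.1 _ (mul_pos hs ht))).le

/-- If `1 ≤ a ^ n * s`, then `m_φ(s) ≤ k(a) ^ n`. -/
theorem QuasiConcave.mPhi_le_kPhi_pow {φ : ℝ → ℝ} (hφ : QuasiConcave φ) {a s : ℝ}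
    (ha : 1 ≤ a) (hs : 0 < s) {n : ℕ} (hn : 1 ≤ a ^ n * s) : mPhi φ s ≤ kPhi φ a ^ n := by
  have hk : 0 ≤ kPhi φ a := zero_le_one.trans (hφ.one_le_kPhi ha)
  refine Real.sSup_le ?_ (by positivity)
  rintro _ ⟨t, ht, -, rfl⟩
  have hst : 0 < s * t := mul_pos hs ht
  rw [div_le_iff₀ (hφ.2.1 _ hst)]
  have hle : t ≤ a ^ n * (s * t) := by
    rw [← mul_assoc]
    exact le_mul_of_one_le_left ht.le hn
  exact (hφ.2.2.1 (Set.mem_Ici.2 ht.le) (Set.mem_Ici.2 (ht.le.trans hle)) hle).trans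
    (hφ.map_pow_mul_le ha hst n)

/-- The power bound `m_φ(s) ≤ k(a) s ^ (-log k(a) / log a)` on `(0,1)`, for every `a > 1`. -/
theorem QuasiConcave.mPhi_le_rpow {φ : ℝ → ℝ} (hφ : QuasiConcave φ) {a s : ℝ}
    (ha : 1 < a) (hs : 0 < s) (hs1 : s < 1) :
    mPhi φ s ≤ kPhi φ a * s ^ (-(Real.log (kPhi φ a) / Real.log a)) := by
  have hk1 := hφ.one_le_kPhi ha.le
  have hk : 0 < kPhi φ a := zero_lt_one.trans_le hk1
  have hla : 0 < Real.log a := Real.log_pos ha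
  have hx : 0 ≤ -Real.log s / Real.log a :=
    div_nonneg (neg_nonneg.2 (Real.log_nonpos hs.le hs1.le)) hla.le
  set n := ⌈-Real.log s / Real.log a⌉₊
  have hn1 : -Real.log s / Real.log a ≤ n := Nat.le_ceil _
  have hn2 : (n : ℝ) ≤ 1 + -Real.log s / Real.log a := by
    linarith [Nat.ceil_lt_add_one hx]
  have hpow : 1 ≤ a ^ n * s := by
    have hpos : 0 < a ^ n * s := by positivity
    rw [← Real.log_nonneg_iff hpos, Real.log_mul (by positivity) hs.ne', Real.log_pow]
    rw [div_le_iff₀ hla] at hn1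
    linarith
  calc mPhi φ s ≤ kPhi φ a ^ n := hφ.mPhi_le_kPhi_pow ha.le hs hpow
    _ = kPhi φ a ^ (n : ℝ) := (Real.rpow_natCast _ _).symm
    _ ≤ kPhi φ a ^ (1 + -Real.log s / Real.log a) := Real.rpow_le_rpow_of_exponent_le hk1 hn2
    _ = kPhi φ a * s ^ (-(Real.log (kPhi φ a) / Real.log a)) := by
      rw [Real.rpow_add hk, Real.rpow_one, Real.rpow_def_of_pos hk, Real.rpow_def_of_pos hs]
      congr 2
      ring

/-- **An upper fundamental (Zippin) index below `1/p` forces the modulus of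
quasi-concavity into `L^p(0,1)`:** if `φ` is quasi-concave, `p ∈ [1,∞)` and
`inf_{s>1} log k(s) / log s < 1/p`, then `∫₀^1 m_φ(s)^p ds < ∞`. -/
theorem modulus_in_Lp_of_upper_fundamental_index_lt
    (φ : ℝ → ℝ) (hφ : QuasiConcave φ) (p : ℝ) (hp : 1 ≤ p)
    (hidx : sInf {y : ℝ | ∃ s : ℝ, 1 < s ∧ y = Real.log (kPhi φ s) / Real.log s} < 1 / p) :
    ∫⁻ s in Set.Ioo (0 : ℝ) 1, ENNReal.ofReal (mPhi φ s ^ p) < ⊤ := by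
  have hp0 : 0 < p := zero_lt_one.trans_le hp
  obtain ⟨_, ⟨a, ha, rfl⟩, hlt⟩ := exists_lt_of_csInf_lt (by exact ⟨_, 2, one_lt_two, rfl⟩) hidx
  set β := Real.log (kPhi φ a) / Real.log a
  have hk : 0 ≤ kPhi φ a := zero_le_one.trans (hφ.one_le_kPhi ha.le)
  have hβp : β * p < 1 := (lt_div_iff₀ hp0).1 hlt
  have hfin : IntegrableOn (fun s : ℝ => kPhi φ a ^ p * s ^ (-(β * p))) (Set.Ioo 0 1) :=
    ((intervalIntegral.integrableOn_Ioo_rpow_iff one_pos).2 (by linarith)).const_mul _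
  refine lt_of_le_of_lt (setLIntegral_mono' measurableSet_Ioo fun s hs => ?_)
    hfin.lintegral_lt_top
  refine ENNReal.ofReal_le_ofReal ?_
  calc mPhi φ s ^ p ≤ (kPhi φ a * s ^ (-β)) ^ p :=
        Real.rpow_le_rpow (hφ.mPhi_nonneg hs.1) (hφ.mPhi_le_rpow ha hs.1 hs.2) hp0.le
    _ = kPhi φ a ^ p * s ^ (-(β * p)) := by
      rw [Real.mul_rpow hk (Real.rpow_nonneg hs.1.le _), ← Real.rpow_mul hs.1.le, neg_mul]
end

section
/- Let p ∈ [1,∞). There is a constant C_p > 0, depending only on p, such that for every nonincreasing f : (0,∞) → [0,∞] and every t > 0: ( ∫₀^t f(s)^p ds )^{1/p} ≤ C_p · ∫₀^t f(s)·s^{1/p − 1} ds. Equivalently, A_p f(t) ≤ C_p · t^{−1/p} ∫₀^t f(s)·s^{1/p} ds/s, i.e., the maximal average A_p f is pointwise dominated by the Hardy-type operator P_{1/p} f. -/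
open MeasureTheory
open scoped ENNReal

/-- A nonincreasing `f` satisfies `f(s) s^{1+r} ≤ ∫₀^t f(u) u^r du` for `0 < s < t` and `r ≤ 0`. -/
theorem AntitoneOn.mul_rpow_le_setLIntegral {f : ℝ → ℝ≥0∞} (hf : AntitoneOn f (Set.Ioi 0))
    {r s t : ℝ} (hr : r ≤ 0) (hs : 0 < s) (hst : s < t) :
    f s * ENNReal.ofReal (s ^ (1 + r)) ≤
      ∫⁻ u in Set.Ioo (0 : ℝ) t, f u * ENNReal.ofReal (u ^ r) := by
  calc f s * ENNReal.ofReal (s ^ (1 + r))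
      = ∫⁻ _ in Set.Ioo (0 : ℝ) s, f s * ENNReal.ofReal (s ^ r) := by
        rw [setLIntegral_const, Real.volume_Ioo, sub_zero, mul_assoc,
          ← ENNReal.ofReal_mul (by positivity), Real.rpow_add hs, Real.rpow_one, mul_comm s]
    _ ≤ ∫⁻ u in Set.Ioo (0 : ℝ) s, f u * ENNReal.ofReal (u ^ r) :=
        setLIntegral_mono' measurableSet_Ioo fun u hu =>
          mul_le_mul' (hf hu.1 hs hu.2.le)
            (ENNReal.ofReal_le_ofReal (Real.rpow_le_rpow_of_nonpos hu.1 hu.2.le hr))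
    _ ≤ ∫⁻ u in Set.Ioo (0 : ℝ) t, f u * ENNReal.ofReal (u ^ r) :=
        lintegral_mono_set (Set.Ioo_subset_Ioo_right hst.le)

/-- **The maximal average is dominated by the Hardy-type operator `P_{1/p}`:** for every
`p ∈ [1,∞)` there is a constant `C_p > 0`, depending only on `p`, such that for every
nonincreasing `f : (0,∞) → [0,∞]` and every `t > 0`,
`(∫₀^t f(s)^p ds)^{1/p} ≤ C_p ∫₀^t f(s) s^{1/p−1} ds`. -/
theorem maximal_average_le_hardy
    (p : ℝ) (hp : 1 ≤ p) :
    ∃ C : ℝ, 0 < C ∧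
      ∀ f : ℝ → ℝ≥0∞, AntitoneOn f (Set.Ioi 0) → ∀ t : ℝ, 0 < t →
        (∫⁻ s in Set.Ioo (0 : ℝ) t, f s ^ p) ^ (1 / p) ≤
          ENNReal.ofReal C *
            ∫⁻ s in Set.Ioo (0 : ℝ) t, f s * ENNReal.ofReal (s ^ (1 / p - 1)) := by
  refine ⟨1, one_pos, fun f hf t _ => ?_⟩
  have hp0 : 0 < p := by linarith
  have hp1 : 0 ≤ p - 1 := by linarith
  have hr : 1 / p - 1 ≤ 0 := by
    rw [sub_nonpos, div_le_one hp0]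
    exact hp
  rw [ENNReal.ofReal_one, one_mul]
  set I := ∫⁻ s in Set.Ioo (0 : ℝ) t, f s * ENNReal.ofReal (s ^ (1 / p - 1)) with hI
  rcases eq_or_ne I ⊤ with hI_top | hI_top
  · exact hI_top ▸ le_top
  have split_rpow (a : ℝ≥0∞) : a ^ p = a * a ^ (p - 1) := by
    conv_lhs => rw [← add_sub_cancel 1 p]
    rw [ENNReal.rpow_add_of_nonneg _ _ zero_le_one hp1, ENNReal.rpow_one]
  have pointwise : ∀ s ∈ Set.Ioo (0 : ℝ) t,
      f s ^ p ≤ f s * ENNReal.ofReal (s ^ (1 / p - 1)) * I ^ (p - 1) := by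
    intro s hs
    have h := ENNReal.rpow_le_rpow (hf.mul_rpow_le_setLIntegral hr hs.1 hs.2) hp1
    rw [← hI, ENNReal.mul_rpow_of_nonneg _ _ hp1,
      ENNReal.ofReal_rpow_of_pos (Real.rpow_pos_of_pos hs.1 _), ← Real.rpow_mul hs.1.le] at h
    have weights : ENNReal.ofReal (s ^ (1 / p - 1)) *
        ENNReal.ofReal (s ^ ((1 + (1 / p - 1)) * (p - 1))) = 1 := by
      rw [← ENNReal.ofReal_mul (Real.rpow_nonneg hs.1.le _), ← Real.rpow_add hs.1]
      have : 1 / p - 1 + (1 + (1 / p - 1)) * (p - 1) = 0 := by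
        field_simp
        ring
      rw [this, Real.rpow_zero, ENNReal.ofReal_one]
    calc f s ^ p = f s * ENNReal.ofReal (s ^ (1 / p - 1)) *
          (f s ^ (p - 1) * ENNReal.ofReal (s ^ ((1 + (1 / p - 1)) * (p - 1)))) := by
          rw [mul_mul_mul_comm, weights, mul_one, split_rpow]
      _ ≤ _ := by gcongr
  calc (∫⁻ s in Set.Ioo (0 : ℝ) t, f s ^ p) ^ (1 / p)
      ≤ (I * I ^ (p - 1)) ^ (1 / p) := by
        refine ENNReal.rpow_le_rpow ?_ (by positivity)
        rw [hI, ← lintegral_mul_const' _ _ (ENNReal.rpow_ne_top_of_nonneg hp1 hI_top)]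
        exact setLIntegral_mono' measurableSet_Ioo pointwise
    _ = I := by
        rw [← split_rpow, ← ENNReal.rpow_mul, mul_one_div_cancel hp0.ne', ENNReal.rpow_one]
end

section
/- Let 1 ≤ q < p < ∞. Then for every nonincreasing f : (0,∞) → [0,∞] and every t > 0: t^{−1/q} ∫₀^t f(s)·s^{1/q − 1} ds ≤ (pq/(p−q)) · ((1/t) ∫₀^t f(s)^p ds)^{1/p}. That is, the Hardy-type operator P_{1/q} f is pointwise dominated by the maximal average A_p f with constant pq/(p−q). -/
open MeasureTheory
open scoped ENNReal

/-- The integral of a power function with exponent `r > -1` over `(0, t)`, in `ℝ≥0∞`. -/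
theorem lintegral_Ioo_ofReal_rpow {r t : ℝ} (hr : -1 < r) (ht : 0 ≤ t) :
    ∫⁻ s in Set.Ioo (0 : ℝ) t, ENNReal.ofReal (s ^ r) =
      ENNReal.ofReal (t ^ (r + 1) / (r + 1)) := by
  have hint : IntegrableOn (fun s : ℝ => s ^ r) (Set.Ioo 0 t) :=
    ((intervalIntegrable_iff_integrableOn_Ioc_of_le ht).1
      (intervalIntegral.intervalIntegrable_rpow' hr)).mono_set Set.Ioo_subset_Ioc_self
  rw [← ofReal_integral_eq_lintegral_ofReal hint, ← integral_Ioc_eq_integral_Ioo,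
    ← intervalIntegral.integral_of_le ht, integral_rpow (Or.inl hr),
    Real.zero_rpow (by linarith), sub_zero]
  filter_upwards [ae_restrict_mem measurableSet_Ioo] with s hs
  exact Real.rpow_nonneg hs.1.le r

/-- The `L^{p'}` norm of `s ↦ s ^ (1/q - 1)` on `(0, t)`, where `p'` is the exponent conjugate
to `p`, is at most `(p q / (p - q)) t ^ (1/q - 1/p)`. -/
theorem lintegral_rpow_conjExponent_le {p q p' t : ℝ} (hpp' : p.HolderConjugate p')
    (hq : 1 ≤ q) (hqp : q < p) (ht : 0 < t) :
    (∫⁻ s in Set.Ioo (0 : ℝ) t, ENNReal.ofReal (s ^ (1 / q - 1)) ^ p') ^ (1 / p') ≤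
      ENNReal.ofReal (p * q / (p - q) * t ^ (1 / q - 1 / p)) := by
  have hp' : 1 < p' := hpp'.symm.lt
  have hp : 1 < p := hpp'.lt
  have hpq : 0 < p - q := sub_pos.2 hqp
  have hp1 : 0 < p - 1 := by linarith
  have hconj : p' = p / (p - 1) := hpp'.conjugate_eq
  have hr : (1 / q - 1) * p' + 1 = (p - q) / (q * (p - 1)) := by
    rw [hconj]; field_simp; ring
  have hr0 : 0 < (1 / q - 1) * p' + 1 := by rw [hr]; positivity
  have hcongr : ∫⁻ s in Set.Ioo (0 : ℝ) t, ENNReal.ofReal (s ^ (1 / q - 1)) ^ p' =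
      ∫⁻ s in Set.Ioo (0 : ℝ) t, ENNReal.ofReal (s ^ ((1 / q - 1) * p')) := by
    refine setLIntegral_congr_fun measurableSet_Ioo fun s hs => ?_
    have hs0 : 0 < s := hs.1
    rw [ENNReal.ofReal_rpow_of_nonneg (Real.rpow_nonneg hs0.le _) (by linarith),
      ← Real.rpow_mul hs0.le]
  rw [hcongr, lintegral_Ioo_ofReal_rpow (by linarith) ht.le,
    ENNReal.ofReal_rpow_of_nonneg (by positivity) (by positivity)]
  refine ENNReal.ofReal_le_ofReal ?_
  have hexp : ((1 / q - 1) * p' + 1) * (1 / p') = 1 / q - 1 / p := by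
    rw [hr, hconj]; field_simp
  have hone : 1 ≤ p * q / (p - q) := by
    rw [le_div_iff₀ hpq]; nlinarith
  rw [div_eq_inv_mul, Real.mul_rpow (by positivity) (by positivity), ← Real.rpow_mul ht.le, hexp]
  gcongr
  calc ((1 / q - 1) * p' + 1)⁻¹ ^ (1 / p')
      ≤ (p * q / (p - q)) ^ (1 / p') := by
        gcongr
        rw [hr, inv_div]
        exact div_le_div_of_nonneg_right (by nlinarith) hpq.le
    _ ≤ (p * q / (p - q)) ^ (1 : ℝ) := by
        gcongr
        rw [div_le_one (by linarith)]
        exact hp'.le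
    _ = p * q / (p - q) := Real.rpow_one _

/-- **The Hardy-type operator `P_{1/q}` is dominated by the maximal average `A_p` for
`1 ≤ q < p < ∞`:** for every nonincreasing `f : (0,∞) → [0,∞]` and every `t > 0`,
`t^{−1/q} ∫₀^t f(s) s^{1/q−1} ds ≤ (pq/(p−q)) · ((1/t) ∫₀^t f(s)^p ds)^{1/p}`. -/
theorem hardy_le_maximal_average
    (p q : ℝ) (hq : 1 ≤ q) (hqp : q < p)
    (f : ℝ → ℝ≥0∞) (hf : AntitoneOn f (Set.Ioi 0)) (t : ℝ) (ht : 0 < t) :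
    ENNReal.ofReal (t ^ (-(1 / q))) *
        ∫⁻ s in Set.Ioo (0 : ℝ) t, f s * ENNReal.ofReal (s ^ (1 / q - 1)) ≤
      ENNReal.ofReal (p * q / (p - q)) *
        ((ENNReal.ofReal t)⁻¹ * ∫⁻ s in Set.Ioo (0 : ℝ) t, f s ^ p) ^ (1 / p) := by
  have hp : 1 < p := by linarith
  have hpq : 0 < p - q := sub_pos.2 hqp
  have hpp' : p.HolderConjugate p.conjExponent := .conjExponent hp
  have hfm : AEMeasurable f (volume.restrict (Set.Ioo (0 : ℝ) t)) :=
    aemeasurable_restrict_of_antitoneOn measurableSet_Ioo (hf.mono Set.Ioo_subset_Ioi_self)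
  have hgm : AEMeasurable (fun s : ℝ => ENNReal.ofReal (s ^ (1 / q - 1)))
      (volume.restrict (Set.Ioo (0 : ℝ) t)) := by fun_prop
  have hinv : (ENNReal.ofReal t)⁻¹ ^ (1 / p) = ENNReal.ofReal (t ^ (-(1 / p))) := by
    rw [← ENNReal.ofReal_inv_of_pos ht,
      ENNReal.ofReal_rpow_of_nonneg (by positivity) (by positivity),
      Real.inv_rpow ht.le, Real.rpow_neg ht.le]
  have hpow : t ^ (-(1 / q)) * (p * q / (p - q) * t ^ (1 / q - 1 / p)) =
      p * q / (p - q) * t ^ (-(1 / p)) := by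
    rw [mul_left_comm, ← Real.rpow_add ht]
    congr 2
    ring
  calc _ ≤ ENNReal.ofReal (t ^ (-(1 / q))) *
          ((∫⁻ s in Set.Ioo (0 : ℝ) t, f s ^ p) ^ (1 / p) *
            ENNReal.ofReal (p * q / (p - q) * t ^ (1 / q - 1 / p))) := by
        gcongr
        exact (ENNReal.lintegral_mul_le_Lp_mul_Lq _ hpp' hfm hgm).trans
          (mul_le_mul_right (lintegral_rpow_conjExponent_le hpp' hq hqp ht) _)
    _ = _ := by
        rw [ENNReal.mul_rpow_of_nonneg _ _ (by positivity), hinv, mul_left_comm,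
          ← ENNReal.ofReal_mul (by positivity), hpow, ENNReal.ofReal_mul (by positivity)]
        ring
end
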